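/- Every tie-sensitive single-crossing preference profile (possibly with ties) is single-crossing. More precisely: if a profile is tie-sensitive single-crossing with respect to a linear order ▷ on V, and ▸ is an arbitrary linear order on V, then the profile obtained by resolving every tie (replacing x ∼_i y by x ≻'_i y iff x ▸ y) is a linear extension of the original profile and is single-crossing with respect to the same order ▷. -/

import Mathlib

/-!
Basic framework: preference profiles with possibly incomplete preferences and ties,
structured-preference properties (narcissistic, single-peaked, single-crossing,
tie-sensitive single-crossing), matchings, blocking pairs and stability.
-/

/-- A preference profile: each agent `i` has a weak order `pref i` (transitive and
total) on its acceptable set `acc i`.  `pref i x y` means agent `i` weakly prefers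
`x` to `y`. -/
structure Profile (V : Type*) where
  acc : V → Set V
  pref : V → V → V → Prop
  pref_mem : ∀ i x y, pref i x y → x ∈ acc i ∧ y ∈ acc i
  pref_total : ∀ i x y, x ∈ acc i → y ∈ acc i → pref i x y ∨ pref i y x
  pref_trans : ∀ i x y z, pref i x y → pref i y z → pref i x z

namespace Profile

variable {V : Type*} (P : Profile V)

/-- `i` strictly prefers `x` to `y`. -/
def Strict (i x y : V) : Prop := P.pref i x y ∧ ¬ P.pref i y x

/-- `i` is indifferent between (ties) `x` and `y`. -/
def Indiff (i x y : V) : Prop := P.pref i x y ∧ P.pref i y x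

/-- Acceptability is symmetric between distinct agents. -/
def AccSymm : Prop := ∀ i j : V, i ≠ j → (j ∈ P.acc i ↔ i ∈ P.acc j)

/-- The profile has no ties. -/
def NoTies : Prop := ∀ i x y : V, x ≠ y → ¬ P.Indiff i x y

/-- The profile is complete: `V(≽ᵢ) ∪ {i} = V` for every agent `i`. -/
def IsComplete : Prop := ∀ i : V, P.acc i ∪ {i} = Set.univ

/-- The profile is narcissistic. -/
def Narcissistic : Prop :=
  ∀ i : V, i ∈ P.acc i ∧ ∀ j ∈ P.acc i, j ≠ i → P.Strict i i j

/-- The agents of a set `S` are narcissistic. -/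
def NarcissisticOn (S : Set V) : Prop :=
  ∀ i ∈ S, i ∈ P.acc i ∧ ∀ j ∈ P.acc i, j ≠ i → P.Strict i i j

/-- `X ▷ Y` : every member of `X` strictly precedes every member of `Y` w.r.t. `lt`. -/
def SetBefore (lt : V → V → Prop) (X Y : Set V) : Prop :=
  ∀ x ∈ X, ∀ y ∈ Y, lt x y

/-- `V[x ≻ y]`: the agents that find both `x` and `y` acceptable and strictly
prefer `x` to `y`. -/
def prefersSet (x y : V) : Set V :=
  {i | x ∈ P.acc i ∧ y ∈ P.acc i ∧ P.Strict i x y}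

/-- `V[x ∼ y]`: the agents that find both `x` and `y` acceptable and are
indifferent between them. -/
def tiesSet (x y : V) : Set V :=
  {i | x ∈ P.acc i ∧ y ∈ P.acc i ∧ P.Indiff i x y}

/-- `V[x ≻ y]` restricted to the agents of `S`. -/
def prefersSetOn (S : Set V) (x y : V) : Set V :=
  {i | i ∈ S ∧ x ∈ P.acc i ∧ y ∈ P.acc i ∧ P.Strict i x y}

/-- `V[x ∼ y]` restricted to the agents of `S`. -/
def tiesSetOn (S : Set V) (x y : V) : Set V :=
  {i | i ∈ S ∧ x ∈ P.acc i ∧ y ∈ P.acc i ∧ P.Indiff i x y}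

/-- The profile is single-peaked with respect to the linear order `lt`. -/
def SinglePeakedWrt (lt : V → V → Prop) : Prop :=
  ∀ i x y z : V, x ∈ P.acc i → y ∈ P.acc i → z ∈ P.acc i →
    lt x y → lt y z → P.Strict i x y → P.pref i y z

/-- The profile is single-peaked. -/
def SinglePeaked : Prop :=
  ∃ lt : V → V → Prop, IsStrictTotalOrder V lt ∧ P.SinglePeakedWrt lt

/-- The preferences of the agents of `S` are single-peaked w.r.t. `lt`. -/
def SinglePeakedWrtOn (S : Set V) (lt : V → V → Prop) : Prop :=
  ∀ i ∈ S, ∀ x y z : V, x ∈ P.acc i → y ∈ P.acc i → z ∈ P.acc i →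
    lt x y → lt y z → P.Strict i x y → P.pref i y z

/-- The profile is tie-sensitive single-crossing with respect to `lt`:
for each pair `{x, y}` of distinct agents either
`V[x ≻ y] ▷ V[x ∼ y] ▷ V[y ≻ x]` or `V[y ≻ x] ▷ V[x ∼ y] ▷ V[x ≻ y]`. -/
def TSSingleCrossingWrt (lt : V → V → Prop) : Prop :=
  ∀ x y : V, x ≠ y →
    (SetBefore lt (P.prefersSet x y) (P.tiesSet x y) ∧
     SetBefore lt (P.tiesSet x y) (P.prefersSet y x) ∧
     SetBefore lt (P.prefersSet x y) (P.prefersSet y x)) ∨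
    (SetBefore lt (P.prefersSet y x) (P.tiesSet x y) ∧
     SetBefore lt (P.tiesSet x y) (P.prefersSet x y) ∧
     SetBefore lt (P.prefersSet y x) (P.prefersSet x y))

/-- The profile is tie-sensitive single-crossing. -/
def TSSingleCrossing : Prop :=
  ∃ lt : V → V → Prop, IsStrictTotalOrder V lt ∧ P.TSSingleCrossingWrt lt

/-- Tie-sensitive single-crossingness of the preferences of the agents of `S`. -/
def TSSingleCrossingWrtOn (S : Set V) (lt : V → V → Prop) : Prop :=
  ∀ x y : V, x ≠ y →
    (SetBefore lt (P.prefersSetOn S x y) (P.tiesSetOn S x y) ∧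
     SetBefore lt (P.tiesSetOn S x y) (P.prefersSetOn S y x) ∧
     SetBefore lt (P.prefersSetOn S x y) (P.prefersSetOn S y x)) ∨
    (SetBefore lt (P.prefersSetOn S y x) (P.tiesSetOn S x y) ∧
     SetBefore lt (P.tiesSetOn S x y) (P.prefersSetOn S x y) ∧
     SetBefore lt (P.prefersSetOn S y x) (P.prefersSetOn S x y))

/-- `ext` is a linear extension of the profile: for every agent `i`, `ext i` is a
strict linear order on the acceptable set `acc i` that contains `Strict i`. -/
def IsLinearExt (ext : V → V → V → Prop) : Prop :=
  (∀ i x y, ext i x y → x ∈ P.acc i ∧ y ∈ P.acc i) ∧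
  (∀ i x, ¬ ext i x x) ∧
  (∀ i x y z, ext i x y → ext i y z → ext i x z) ∧
  (∀ i x y, x ∈ P.acc i → y ∈ P.acc i → x ≠ y → (ext i x y ∨ ext i y x)) ∧
  (∀ i x y, ext i x y → ¬ ext i y x) ∧
  (∀ i x y, P.Strict i x y → ext i x y)

/-- `V[x ≻' y]` for a linear extension `ext`. -/
def extPrefersSet (ext : V → V → V → Prop) (x y : V) : Set V :=
  {i | x ∈ P.acc i ∧ y ∈ P.acc i ∧ ext i x y}

/-- The linear extension `ext` witnesses single-crossingness w.r.t. `lt`. -/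
def SingleCrossingWrtVia (ext : V → V → V → Prop) (lt : V → V → Prop) : Prop :=
  ∀ x y : V, x ≠ y →
    SetBefore lt (P.extPrefersSet ext x y) (P.extPrefersSet ext y x) ∨
    SetBefore lt (P.extPrefersSet ext y x) (P.extPrefersSet ext x y)

/-- The profile is single-crossing with respect to `lt`: some linear extension
of the profile crosses each pair at most once along `lt`. -/
def SingleCrossingWrt (lt : V → V → Prop) : Prop :=
  ∃ ext : V → V → V → Prop, P.IsLinearExt ext ∧ P.SingleCrossingWrtVia ext lt

/-- The profile is single-crossing. -/
def SingleCrossing : Prop :=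
  ∃ lt : V → V → Prop, IsStrictTotalOrder V lt ∧ P.SingleCrossingWrt lt

/-- Single-crossingness w.r.t. `lt` for profiles without ties, stated directly via
the strict preferences. -/
def SCNoTiesWrt (lt : V → V → Prop) : Prop :=
  ∀ x y : V, x ≠ y →
    SetBefore lt (P.prefersSet x y) (P.prefersSet y x) ∨
    SetBefore lt (P.prefersSet y x) (P.prefersSet x y)

/-- `x` is a most acceptable agent of `y`. -/
def MostAcceptable (x y : V) : Prop :=
  x ∈ P.acc y ∧ x ≠ y ∧ ∀ z ∈ P.acc y, z ≠ x → z ≠ y → P.pref y x z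

/-- A matching: a set of pairwise disjoint pairs of distinct, mutually acceptable
agents, encoded by the partner function `m` (`m x = none` iff `x` is unmatched). -/
structure Matching (Q : Profile V) where
  m : V → Option V
  ne : ∀ x y, m x = some y → x ≠ y
  mutual_acc : ∀ x y, m x = some y → y ∈ Q.acc x ∧ x ∈ Q.acc y
  symm : ∀ x y, m x = some y → m y = some x

/-- The (mutually acceptable, unmatched) pair `{x, y}` blocks the matching `M`. -/
def Matching.Blocks {Q : Profile V} (M : Q.Matching) (x y : V) : Prop :=
  x ≠ y ∧ y ∈ Q.acc x ∧ x ∈ Q.acc y ∧ M.m x ≠ some y ∧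
  (∀ z, M.m x = some z → Q.Strict x y z) ∧
  (∀ z, M.m y = some z → Q.Strict y x z)

/-- A matching is stable if no pair blocks it. -/
def Matching.Stable {Q : Profile V} (M : Q.Matching) : Prop :=
  ∀ x y : V, ¬ M.Blocks x y

/-- A matching is perfect if every agent is matched. -/
def Matching.Perfect {Q : Profile V} (M : Q.Matching) : Prop :=
  ∀ x : V, M.m x ≠ none

/-- Build a profile from ranking functions (`none` = unacceptable, smaller rank =
more preferred). -/
def ofRank {V : Type*} (rk : V → V → Option ℕ) : Profile V where
  acc i := {x | rk i x ≠ none}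
  pref i x y := ∃ a b : ℕ, rk i x = some a ∧ rk i y = some b ∧ a ≤ b
  pref_mem i x y := by
    rintro ⟨a, b, ha, hb, -⟩
    constructor <;> simp only [Set.mem_setOf_eq, ha, hb] <;> simp
  pref_total i x y hx hy := by
    obtain ⟨a, ha⟩ := Option.ne_none_iff_exists'.mp hx
    obtain ⟨b, hb⟩ := Option.ne_none_iff_exists'.mp hy
    rcases le_total a b with h | h
    · exact Or.inl ⟨a, b, ha, hb, h⟩
    · exact Or.inr ⟨b, a, hb, ha, h⟩
  pref_trans i x y z := by
    rintro ⟨a, b, ha, hb, hab⟩ ⟨b', c, hb', hc, hbc⟩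
    refine ⟨a, c, ha, hc, hab.trans ?_⟩
    rw [hb] at hb'
    rwa [Option.some_inj.mp hb']

end Profile

/-- If a profile is tie-sensitive single-crossing w.r.t. a linear
order `lt`, and `blt` is an arbitrary linear order on the agents, then resolving
every tie according to `blt` yields a linear extension of the profile which is
single-crossing w.r.t. the same order `lt`.  In particular every tie-sensitive
single-crossing profile is single-crossing. -/
theorem tssc_implies_sc {V : Type*} [Fintype V] (P : Profile V) (hsymm : P.AccSymm)
    (lt blt : V → V → Prop) (hlt : IsStrictTotalOrder V lt)
    (hblt : IsStrictTotalOrder V blt)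
    (h : P.TSSingleCrossingWrt lt) :
    P.IsLinearExt (fun i x y => P.Strict i x y ∨ (P.Indiff i x y ∧ x ≠ y ∧ blt x y)) ∧
    P.SingleCrossingWrtVia
      (fun i x y => P.Strict i x y ∨ (P.Indiff i x y ∧ x ≠ y ∧ blt x y)) lt := by
  have irr : ∀ a, ¬ blt a a := hblt.irrefl
  have tr : ∀ a b c, blt a b → blt b c → blt a c := hblt.trans
  have tri : ∀ a b, a ≠ b → blt a b ∨ blt b a := fun a b hab => by
    by_contra! hn
    exact hab (hblt.trichotomous a b hn.1 hn.2)
  refine ⟨⟨?_, ?_, ?_, ?_, ?_, fun i x y hs => Or.inl hs⟩, ?_⟩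
  · rintro i x y (hs | hs)
    · exact P.pref_mem i x y hs.1
    · exact P.pref_mem i x y hs.1.1
  · rintro i x (hs | hs)
    · exact hs.2 hs.1
    · exact hs.2.1 rfl
  · intro i x y z hxy hyz
    have htr := P.pref_trans i
    have hxz : x = z → blt x y → ¬ blt y z := by
      rintro rfl h₁ h₂
      exact irr x (tr x y x h₁ h₂)
    rcases hxy with ⟨h₁, h₂⟩ | ⟨⟨h₁, h₂⟩, -, h₃⟩ <;>
      rcases hyz with ⟨k₁, k₂⟩ | ⟨⟨k₁, k₂⟩, -, k₃⟩
    · exact Or.inl ⟨htr x y z h₁ k₁, fun hzx => h₂ (htr y z x k₁ hzx)⟩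
    · exact Or.inl ⟨htr x y z h₁ k₁, fun hzx => h₂ (htr y z x k₁ hzx)⟩
    · exact Or.inl ⟨htr x y z h₁ k₁, fun hzx => k₂ (htr z x y hzx h₁)⟩
    · exact Or.inr ⟨⟨htr x y z h₁ k₁, htr z y x k₂ h₂⟩, fun e => hxz e h₃ k₃,
        tr x y z h₃ k₃⟩
  · intro i x y hx hy hne
    have htot := P.pref_total i x y hx hy
    have := tri x y hne
    have := hne.symm
    simp only [Profile.Strict, Profile.Indiff]
    tauto
  · rintro i x y (⟨h₁, h₂⟩ | ⟨⟨h₁, h₂⟩, -, h₃⟩) (⟨k₁, k₂⟩ | ⟨⟨k₁, k₂⟩, -, k₃⟩)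
    · exact h₂ k₁
    · exact h₂ k₁
    · exact k₂ h₁
    · exact irr x (tr x y x h₃ k₃)
  · intro x y hne
    have hxy : blt x y → ¬ blt y x := fun h₁ h₂ => irr x (tr x y x h₁ h₂)
    have htie : ∀ i, P.Indiff i y x → P.Indiff i x y := fun i hi => ⟨hi.2, hi.1⟩
    rcases h x y hne with ⟨h₁, h₂, h₃⟩ | ⟨h₁, h₂, h₃⟩
    · left
      rintro i ⟨hx, hy, hi⟩ j ⟨hy', hx', hj⟩
      rcases hi with hi | ⟨hi, -, hb⟩ <;> rcases hj with hj | ⟨hj, -, hb'⟩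
      · exact h₃ i ⟨hx, hy, hi⟩ j ⟨hy', hx', hj⟩
      · exact h₁ i ⟨hx, hy, hi⟩ j ⟨hx', hy', htie j hj⟩
      · exact h₂ i ⟨hx, hy, hi⟩ j ⟨hy', hx', hj⟩
      · exact absurd hb' (hxy hb)
    · right
      rintro i ⟨hy, hx, hi⟩ j ⟨hx', hy', hj⟩
      rcases hi with hi | ⟨hi, -, hb⟩ <;> rcases hj with hj | ⟨hj, -, hb'⟩
      · exact h₃ i ⟨hy, hx, hi⟩ j ⟨hx', hy', hj⟩
      · exact h₁ i ⟨hy, hx, hi⟩ j ⟨hx', hy', hj⟩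
      · exact h₂ i ⟨hx, hy, htie i hi⟩ j ⟨hx', hy', hj⟩
      · exact absurd hb (hxy hb')
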